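/- The inducibility of H33 equals 4/9; that is, the sequence a_n = (max{N(H33,G) : G an oriented graph on n vertices}) / C(n,4) tends to 4/9 as n → ∞. -/

import Mathlib

/-- The number of induced copies of a `k`-vertex oriented graph `H` in an oriented
graph `G`. -/
noncomputable def inducedCopies {k : ℕ} (H : Fin k → Fin k → Prop) {V : Type}
    [Fintype V] [DecidableEq V] (G : V → V → Prop) : ℕ :=
  Set.ncard {S : Finset V | ∃ f : Fin k → V, Function.Injective f ∧
    Finset.univ.image f = S ∧ ∀ i j, H i j ↔ G (f i) (f j)}

/-- The oriented graph on 4 vertices with arcs 1→3, 2→3, 3→4, 4→1, 4→2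
(vertices 1 and 2 non-adjacent), here on `Fin 4` as 0→2, 1→2, 2→3, 3→0, 3→1. -/
def H33 : Fin 4 → Fin 4 → Prop := fun i j =>
  (i = 0 ∧ j = 2) ∨ (i = 1 ∧ j = 2) ∨ (i = 2 ∧ j = 3) ∨ (i = 3 ∧ j = 0) ∨ (i = 3 ∧ j = 1)

/-- The maximum number of induced copies of `H` over all oriented graphs on `n` vertices. -/
noncomputable def maxCopies {k : ℕ} (H : Fin k → Fin k → Prop) (n : ℕ) : ℕ :=
  sSup {m : ℕ | ∃ G : Fin n → Fin n → Prop,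
    (∀ u v, ¬ (G u v ∧ G v u)) ∧ m = inducedCopies H G}

open Finset in
/-- The product of the sizes of three pairwise disjoint sets of vertices is at most that of a
balanced tripartition. -/
theorem card_mul_card_mul_card_le {V : Type*} [Fintype V] [DecidableEq V] (A B C : Finset V)
    (hAB : Disjoint A B) (hAC : Disjoint A C) (hBC : Disjoint B C) :
    27 * (#A * #B * #C) ≤ Fintype.card V ^ 3 := by
  have h : #A + #B + #C ≤ Fintype.card V := by
    rw [← card_union_of_disjoint hAB,
      ← card_union_of_disjoint (disjoint_union_left.2 ⟨hAC, hBC⟩)]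
    exact card_le_univ _
  refine le_trans ?_ (Nat.pow_le_pow_left h 3)
  generalize #A = a
  generalize #B = b
  generalize #C = c
  zify
  nlinarith [mul_nonneg (Int.natCast_nonneg a) (sq_nonneg ((b : ℤ) - c)),
    mul_nonneg (Int.natCast_nonneg b) (sq_nonneg ((a : ℤ) - c)),
    mul_nonneg (Int.natCast_nonneg c) (sq_nonneg ((a : ℤ) - b)),
    mul_nonneg (Int.natCast_nonneg a) (sq_nonneg ((a : ℤ) - b)),
    mul_nonneg (Int.natCast_nonneg a) (sq_nonneg ((a : ℤ) - c)),
    mul_nonneg (Int.natCast_nonneg b) (sq_nonneg ((a : ℤ) - b)),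
    mul_nonneg (Int.natCast_nonneg b) (sq_nonneg ((b : ℤ) - c)),
    mul_nonneg (Int.natCast_nonneg c) (sq_nonneg ((a : ℤ) - c)),
    mul_nonneg (Int.natCast_nonneg c) (sq_nonneg ((b : ℤ) - c))]

/-- The induced embeddings of `H33` into `G`. -/
def H33Embeddings {V : Type} (G : V → V → Prop) : Set (Fin 4 → V) :=
  {f | Function.Injective f ∧ ∀ i j, H33 i j ↔ G (f i) (f j)}

theorem H33_swap (i j : Fin 4) : H33 (Equiv.swap 0 1 i) (Equiv.swap 0 1 j) ↔ H33 i j := by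
  unfold H33
  revert i j
  decide

theorem two_mul_inducedCopies_H33_le {V : Type} [Fintype V] [DecidableEq V]
    (G : V → V → Prop) : 2 * inducedCopies H33 G ≤ (H33Embeddings G).ncard := by
  classical
  set 𝒮 := {S : Finset V | ∃ f : Fin 4 → V, Function.Injective f ∧
    Finset.univ.image f = S ∧ ∀ i j, H33 i j ↔ G (f i) (f j)}
  choose f hinj himg hadj using fun S : 𝒮 => S.2
  let g : Bool × 𝒮 → H33Embeddings G := fun p =>
    bif p.1 then ⟨f p.2 ∘ Equiv.swap 0 1, (hinj p.2).comp (Equiv.injective _),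
      fun i j => by rw [← H33_swap]; exact hadj p.2 _ _⟩
    else ⟨f p.2, hinj p.2, hadj p.2⟩
  have himage : ∀ p, Finset.univ.image (g p).1 = p.2.1 := by
    rintro ⟨b, S⟩
    cases b
    · exact himg S
    · simp only [g, cond_true]
      rw [← Finset.image_image, Finset.image_univ_equiv, himg]
  have hg : Function.Injective g := by
    rintro ⟨b, S⟩ ⟨c, T⟩ h
    have hST : S = T := Subtype.ext <| by
      rw [← himage (b, S), h, himage]
    subst hST
    have h0 := congrFun (congrArg Subtype.val h) 0
    cases b <;> cases c <;> simp [g, (hinj S).eq_iff] at h0 ⊢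
  have := Nat.card_le_card_of_injective g hg
  rw [Nat.card_prod, Nat.card_eq_fintype_card (α := Bool), Fintype.card_bool] at this
  exact this

theorem ncard_H33Embeddings_le {V : Type} [Fintype V] [DecidableEq V] (G : V → V → Prop)
    (hG : ∀ u v, ¬ (G u v ∧ G v u)) :
    27 * (H33Embeddings G).ncard ≤ Fintype.card V ^ 4 := by
  classical
  let out : V → Finset V := fun v => {w | G v w}
  let inn : V → Finset V := fun v => {w | G w v}
  let non : V → Finset V := fun v => {w | ¬ G v w ∧ ¬ G w v}
  let T : Finset (Σ _ : V, V × V × V) := Finset.univ.sigma fun v => out v ×ˢ inn v ×ˢ non v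
  have hle : (H33Embeddings G).ncard ≤ T.card := by
    rw [← Set.ncard_coe_finset]
    refine Set.ncard_le_ncard_of_injOn (fun f => ⟨f 0, f 2, f 3, f 1⟩) ?_ ?_ (Finset.finite_toSet _)
    · rintro f ⟨-, hf⟩
      simp [T, out, inn, non, ← hf, H33]
    · intro f _ g _ h
      simp only [Sigma.mk.injEq, heq_eq_eq, Prod.mk.injEq] at h
      funext i
      fin_cases i <;> simp_all
  calc 27 * (H33Embeddings G).ncard ≤ 27 * T.card := Nat.mul_le_mul_left _ hle
    _ = ∑ v, 27 * ((out v).card * (inn v).card * (non v).card) := by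
      simp only [T, Finset.card_sigma, Finset.card_product, Finset.mul_sum, mul_assoc]
    _ ≤ ∑ _v : V, Fintype.card V ^ 3 := by
      refine Finset.sum_le_sum fun v _ => card_mul_card_mul_card_le _ _ _ ?_ ?_ ?_ <;>
        refine Finset.disjoint_left.2 fun w => ?_ <;>
        have := hG v w <;> simp only [out, inn, non, Finset.mem_filter] <;> tauto
    _ = Fintype.card V ^ 4 := by
      simp only [Finset.sum_const, Finset.card_univ, smul_eq_mul]
      ring

theorem inducedCopies_H33_le {V : Type} [Fintype V] [DecidableEq V] (G : V → V → Prop)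
    (hG : ∀ u v, ¬ (G u v ∧ G v u)) : 54 * inducedCopies H33 G ≤ Fintype.card V ^ 4 := by
  have h₁ := two_mul_inducedCopies_H33_le G
  have h₂ := ncard_H33Embeddings_le G hG
  omega

/-- The balanced blow-up of the directed triangle on `n` vertices. -/
def triangleBlowup (n : ℕ) (u v : Fin n) : Prop := v.val % 3 = (u.val + 1) % 3

theorem triangleBlowup_asymm (n : ℕ) (u v : Fin n) :
    ¬ (triangleBlowup n u v ∧ triangleBlowup n v u) := by
  unfold triangleBlowup
  omega

theorem le_inducedCopies_triangleBlowup (n m : ℕ) (h : 3 * m ≤ n) :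
    3 * (m * (m - 1) * m ^ 2) ≤ 2 * inducedCopies H33 (triangleBlowup n) := by
  classical
  let T : Finset ((Σ _ : ℕ, ℕ) × ℕ × ℕ × ℕ) :=
    ((Finset.range m).sigma fun j => Finset.range j) ×ˢ
      Finset.range m ×ˢ Finset.range m ×ˢ Finset.range 3
  have hT : 2 * T.card = 3 * (m * (m - 1) * m ^ 2) := by
    have := Finset.sum_range_id_mul_two m
    simp only [T, Finset.card_product, Finset.card_sigma, Finset.card_range]
    rw [← this]
    ring
  rw [← hT]
  refine Nat.mul_le_mul_left 2 ?_
  let φ : (Σ _ : ℕ, ℕ) × ℕ × ℕ × ℕ → Fin 4 → ℕ := fun p =>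
    ![3 * p.1.1 + p.2.2.2, 3 * p.1.2 + p.2.2.2, 3 * p.2.1 + (p.2.2.2 + 1) % 3,
      3 * p.2.2.1 + (p.2.2.2 + 2) % 3]
  have hφ : ∀ p ∈ T, ∀ i, φ p i < n := by
    rintro ⟨⟨j, i⟩, a, b, c⟩ hp k
    simp only [T, Finset.mem_product, Finset.mem_sigma, Finset.mem_range] at hp
    fin_cases k <;> simp [φ] <;> omega
  let e : (Σ _ : ℕ, ℕ) × ℕ × ℕ × ℕ → Finset (Fin n) := fun p => {x | ∃ i, x.val = φ p i}
  rw [← Set.ncard_coe_finset]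
  refine Set.ncard_le_ncard_of_injOn e ?_ ?_ (Set.toFinite _)
  · intro p hp
    refine ⟨fun i => ⟨φ p i, hφ p hp i⟩, ?_, ?_, ?_⟩
    · obtain ⟨⟨j, i⟩, a, b, c⟩ := p
      simp only [T, Finset.mem_coe, Finset.mem_product, Finset.mem_sigma, Finset.mem_range] at hp
      intro k l hkl
      fin_cases k <;> fin_cases l <;> simp [φ] at hkl ⊢ <;> omega
    · ext x
      simp [e, Fin.ext_iff, eq_comm]
    · obtain ⟨⟨j, i⟩, a, b, c⟩ := p
      simp only [T, Finset.mem_coe, Finset.mem_product, Finset.mem_sigma, Finset.mem_range] at hp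
      intro k l
      fin_cases k <;> fin_cases l <;> simp [φ, triangleBlowup, H33] <;> omega
  · intro p hp q hq hpq
    have hmem : ∀ i, ∃ j, φ p i = φ q j := fun i => by
      have : (⟨φ p i, hφ p hp i⟩ : Fin n) ∈ e q := by
        rw [← hpq]
        simp [e]
      simpa [e] using this
    obtain ⟨⟨j, i⟩, a, b, c⟩ := p
    obtain ⟨⟨j', i'⟩, a', b', c'⟩ := q
    simp only [T, Finset.mem_coe, Finset.mem_product, Finset.mem_sigma, Finset.mem_range] at hp hq
    have h0 := hmem 0
    have h1 := hmem 1
    have h2 := hmem 2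
    have h3 := hmem 3
    simp [φ, Fin.exists_fin_succ] at h0 h1 h2 h3
    obtain ⟨⟨hj, hi⟩, ha, hb, hc⟩ := hp
    obtain ⟨⟨hj', hi'⟩, ha', hb', hc'⟩ := hq
    have hcc : c = c' := by omega
    subst hcc
    have hjj : j = j' := by omega
    have hii : i = i' := by omega
    have haa : a = a' := by omega
    have hbb : b = b' := by omega
    subst hjj hii haa hbb
    rfl

theorem stmt6 :
    Filter.Tendsto (fun n : ℕ => (maxCopies H33 n : ℝ) / (Nat.choose n 4 : ℝ))
      Filter.atTop (nhds (4 / 9)) := by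
  have hbound : ∀ n, ∀ m ∈ {m : ℕ | ∃ G : Fin n → Fin n → Prop,
      (∀ u v, ¬ (G u v ∧ G v u)) ∧ m = inducedCopies H33 G}, 54 * m ≤ n ^ 4 := by
    rintro n m ⟨G, hG, rfl⟩
    simpa using inducedCopies_H33_le G hG
  have hupper : ∀ n, 54 * maxCopies H33 n ≤ n ^ 4 := fun n =>
    hbound n _ <| Nat.sSup_mem ⟨_, triangleBlowup n, triangleBlowup_asymm n, rfl⟩
      ⟨n ^ 4, fun m hm => by have := hbound n m hm; omega⟩
  have hlower : ∀ n, 3 * (n / 3 * (n / 3 - 1) * (n / 3) ^ 2) ≤ 2 * maxCopies H33 n := fun n =>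
    (le_inducedCopies_triangleBlowup n (n / 3) (Nat.mul_div_le n 3)).trans <|
      Nat.mul_le_mul_left 2 <| le_csSup
        ⟨n ^ 4, fun m hm => by have := hbound n m hm; omega⟩
        ⟨triangleBlowup n, triangleBlowup_asymm n, rfl⟩
  have hlim : ∀ c : ℝ, Filter.Tendsto (fun n : ℕ => (1 - c / n) ^ 4) Filter.atTop (nhds 1) := by
    intro c
    simpa using ((tendsto_const_nhds (x := (1 : ℝ))).sub
      (tendsto_const_div_atTop_nhds_zero_nat c)).pow 4
  have hlo : Filter.Tendsto (fun n : ℕ => 4 / 9 * (1 - 5 / (n : ℝ)) ^ 4) Filter.atTop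
      (nhds (4 / 9)) := by
    simpa using (hlim 5).const_mul (4 / 9)
  have hup : Filter.Tendsto (fun n : ℕ => 4 / 9 / (1 - 3 / (n : ℝ)) ^ 4) Filter.atTop
      (nhds (4 / 9)) := by
    simpa [Pi.div_def] using (tendsto_const_nhds (x := (4 / 9 : ℝ))).div (hlim 3) one_ne_zero
  refine tendsto_of_tendsto_of_tendsto_of_le_of_le' hlo hup ?_ ?_
  · filter_upwards [Filter.eventually_ge_atTop 6] with n hn
    have hn' : (6 : ℝ) ≤ n := by exact_mod_cast hn
    have hpos : (0 : ℝ) < n.choose 4 := by exact_mod_cast Nat.choose_pos (by omega)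
    have hchoose : (n.choose 4 : ℝ) ≤ n ^ 4 / 24 := by
      simpa [Nat.factorial] using Nat.choose_le_pow_div (α := ℝ) 4 n
    rw [le_div_iff₀ hpos]
    obtain ⟨k, hk⟩ : ∃ k, n / 3 = k + 1 := ⟨n / 3 - 1, by omega⟩
    have hl := hlower n
    rw [hk, Nat.add_sub_cancel] at hl
    have hk' : ((n : ℝ) - 5) / 3 ≤ k := by
      have : n ≤ 3 * k + 5 := by omega
      have : (n : ℝ) ≤ 3 * k + 5 := by exact_mod_cast this
      linarith
    have hl' : (3 : ℝ) * ((k + 1) * k * (k + 1) ^ 2) ≤ 2 * maxCopies H33 n := by exact_mod_cast hl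
    have hpow : (((n : ℝ) - 5) / 3) ^ 4 ≤ k ^ 4 :=
      pow_le_pow_left₀ (by linarith) hk' 4
    have hk4 : (k : ℝ) ^ 4 ≤ (k + 1) * k * (k + 1) ^ 2 := by
      have : (0 : ℝ) ≤ k := k.cast_nonneg
      have : 0 ≤ 3 * (k : ℝ) ^ 3 + 3 * k ^ 2 + k := by positivity
      linarith
    calc 4 / 9 * (1 - 5 / (n : ℝ)) ^ 4 * n.choose 4
        ≤ 4 / 9 * (1 - 5 / (n : ℝ)) ^ 4 * (n ^ 4 / 24) := by gcongr
      _ = 3 / 2 * (((n : ℝ) - 5) / 3) ^ 4 := by field_simp; ring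
      _ ≤ maxCopies H33 n := by linarith
  · filter_upwards [Filter.eventually_ge_atTop 4] with n hn
    have hn' : (4 : ℝ) ≤ n := by exact_mod_cast hn
    have hpos : (0 : ℝ) < n.choose 4 := by exact_mod_cast Nat.choose_pos hn
    have hchoose : ((n : ℝ) - 3) ^ 4 ≤ 24 * n.choose 4 := by
      have := Nat.pow_sub_le_descFactorial n 4
      rw [Nat.descFactorial_eq_factorial_mul_choose] at this
      have h : (((n + 1 - 4 : ℕ) : ℝ)) ^ 4 ≤ 24 * n.choose 4 := by exact_mod_cast this
      rwa [Nat.cast_sub (by omega), show ((n + 1 : ℕ) : ℝ) - (4 : ℕ) = n - 3 by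
        push_cast; ring] at h
    have hu : (54 : ℝ) * maxCopies H33 n ≤ n ^ 4 := by exact_mod_cast hupper n
    have hsub : (0 : ℝ) < n - 3 := by linarith
    have hrw : 4 / 9 / (1 - 3 / (n : ℝ)) ^ 4 = (n ^ 4 / 54) / ((n - 3) ^ 4 / 24) := by
      have : (1 - 3 / (n : ℝ)) = (n - 3) / n := by field_simp
      rw [this]
      field_simp
      norm_num
    rw [hrw]
    gcongr <;> linarith
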